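/- arXiv:2409.17098 — 2 statements merged into one kernel-verified Lean document; each statement's English description precedes it below -/
import Mathlib

section
/- For any point placement P of n points, the sum over all 3-element subsets T of P of the number of 2-element subsets {x, y} ⊆ P \ T such that x and y are both γ-points of T lying in distinct regions with respect to T equals 5·P₅(P) + U(P). -/
open Finset

/-- A finite set of points in the plane is in *general position* if no three of
its points are collinear. -/
def GenPos (P : Finset (ℝ × ℝ)) : Prop :=
  ∀ x ∈ P, ∀ y ∈ P, ∀ z ∈ P, x ≠ y → x ≠ z → y ≠ z →
    ¬ Collinear ℝ ({x, y, z} : Set (ℝ × ℝ))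

/-- A finite set of points is in *convex position* if every point of it is an
extreme point of its convex hull. -/
def ConvexPos (S : Finset (ℝ × ℝ)) : Prop :=
  ∀ x ∈ S, x ∈ Set.extremePoints ℝ (convexHull ℝ (S : Set (ℝ × ℝ)))

open scoped Classical in
/-- Number of `k`-element subsets of `P` that are in convex position. -/
noncomputable def convexPosCount (P : Finset (ℝ × ℝ)) (k : ℕ) : ℕ :=
  ((P.powersetCard k).filter fun S => ConvexPos S).card

/-- `mu k n` is the minimum number of `k`-element subsets in convex position over
all placements of `n` points in general position. -/
noncomputable def mu (k n : ℕ) : ℕ :=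
  sInf {m | ∃ P : Finset (ℝ × ℝ), GenPos P ∧ P.card = n ∧ convexPosCount P k = m}

/-- `x` is a γ-point of `T` if `T ∪ {x}` is in convex position. -/
def IsGammaPt (T : Finset (ℝ × ℝ)) (x : ℝ × ℝ) : Prop :=
  ConvexPos (insert x T)

/-- `x` is a β-point of `T` if `T ∪ {x}` is not in convex position and `x` does not
lie in the convex hull of `T`. -/
def IsBetaPt (T : Finset (ℝ × ℝ)) (x : ℝ × ℝ) : Prop :=
  ¬ ConvexPos (insert x T) ∧ x ∉ convexHull ℝ (T : Set (ℝ × ℝ))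

open scoped Classical in
/-- `γ_T`: number of γ-points of `T` among the points of `P \ T`. -/
noncomputable def gammaCount (P T : Finset (ℝ × ℝ)) : ℕ :=
  ((P \ T).filter fun x => IsGammaPt T x).card

open scoped Classical in
/-- `β_T`: number of β-points of `T` among the points of `P \ T`. -/
noncomputable def betaCount (P T : Finset (ℝ × ℝ)) : ℕ :=
  ((P \ T).filter fun x => IsBetaPt T x).card

open scoped Classical in
/-- Number of `k`-element subsets of `P` whose convex hull has exactly `j`
extreme points. -/
noncomputable def hullCount (P : Finset (ℝ × ℝ)) (k j : ℕ) : ℕ :=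
  ((P.powersetCard k).filter fun S =>
    (Set.extremePoints ℝ (convexHull ℝ (S : Set (ℝ × ℝ)))).ncard = j).card

/-- `x` and `y` lie strictly on the same side of the line through `p` and `q`. -/
def SameSide (p q x y : ℝ × ℝ) : Prop :=
  0 < ((q.1 - p.1) * (x.2 - p.2) - (q.2 - p.2) * (x.1 - p.1)) *
      ((q.1 - p.1) * (y.2 - p.2) - (q.2 - p.2) * (y.1 - p.1))

/-- `x` and `y` lie in the same region with respect to `T`: for each pair of
distinct points of `T`, they lie strictly on the same side of the line through them. -/
def SameRegion (T : Finset (ℝ × ℝ)) (x y : ℝ × ℝ) : Prop :=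
  ∀ p ∈ T, ∀ q ∈ T, p ≠ q → SameSide p q x y

open scoped Classical in
/-- Number of 2-element subsets `{x, y}` of `P \ T` such that `x` and `y` are both
γ-points of `T` lying in the same region with respect to `T`. -/
noncomputable def gammaSamePairs (P T : Finset (ℝ × ℝ)) : ℕ :=
  (((P \ T).powersetCard 2).filter fun S =>
    (∀ x ∈ S, IsGammaPt T x) ∧ ∀ x ∈ S, ∀ y ∈ S, x ≠ y → SameRegion T x y).card

open scoped Classical in
/-- Number of 2-element subsets `{x, y}` of `P \ T` such that `x` and `y` are both
γ-points of `T` lying in distinct regions with respect to `T`. -/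
noncomputable def gammaDiffPairs (P T : Finset (ℝ × ℝ)) : ℕ :=
  (((P \ T).powersetCard 2).filter fun S =>
    (∀ x ∈ S, IsGammaPt T x) ∧ ∀ x ∈ S, ∀ y ∈ S, x ≠ y → ¬ SameRegion T x y).card

open scoped Classical in
/-- Number of 2-element subsets `{x, y}` of `P \ T` such that `x` and `y` are both
β-points of `T` lying in the same region with respect to `T`. -/
noncomputable def betaSamePairs (P T : Finset (ℝ × ℝ)) : ℕ :=
  (((P \ T).powersetCard 2).filter fun S =>
    (∀ x ∈ S, IsBetaPt T x) ∧ ∀ x ∈ S, ∀ y ∈ S, x ≠ y → SameRegion T x y).card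

open scoped Classical in
/-- Number of 2-element subsets `{x, y}` of `P \ T` such that `x` and `y` are both
β-points of `T` lying in distinct regions with respect to `T`. -/
noncomputable def betaDiffPairs (P T : Finset (ℝ × ℝ)) : ℕ :=
  (((P \ T).powersetCard 2).filter fun S =>
    (∀ x ∈ S, IsBetaPt T x) ∧ ∀ x ∈ S, ∀ y ∈ S, x ≠ y → ¬ SameRegion T x y).card

/-- Twice the signed area of the triangle `p q x`. -/
def cross (p q x : ℝ × ℝ) : ℝ :=
  (q.1 - p.1) * (x.2 - p.2) - (q.2 - p.2) * (x.1 - p.1)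

theorem cross_rotate (p q x : ℝ × ℝ) : cross q x p = cross p q x := by
  unfold cross; ring

theorem cross_swap (p q x : ℝ × ℝ) : cross q p x = -cross p q x := by
  unfold cross; ring

theorem collinear_of_cross_eq_zero {p q x : ℝ × ℝ} (hpq : p ≠ q) (h : cross p q x = 0) :
    Collinear ℝ ({p, q, x} : Set (ℝ × ℝ)) := by
  rw [collinear_iff_of_mem (p₀ := p) (by simp)]
  refine ⟨q - p, ?_⟩
  have key : ∃ r : ℝ, x = r • (q - p) + p := by
    unfold cross at h
    by_cases h1 : q.1 - p.1 = 0
    · have h2 : q.2 - p.2 ≠ 0 := fun h2 =>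
        hpq (Prod.ext (by linarith) (by linarith))
      refine ⟨(x.2 - p.2) / (q.2 - p.2), Prod.ext ?_ ?_⟩
      · have : x.1 - p.1 = 0 := by
          rw [h1] at h
          simpa [h2] using h
        simp [h1]
        linarith
      · simp [h2]
    · refine ⟨(x.1 - p.1) / (q.1 - p.1), Prod.ext ?_ ?_⟩
      · simp [h1]
      · simp
        field_simp
        linarith
  simp only [Set.mem_insert_iff, Set.mem_singleton_iff, vadd_eq_add]
  rintro y (rfl | rfl | rfl)
  · exact ⟨0, by simp⟩
  · exact ⟨1, by simp⟩
  · exact key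

theorem mem_convexHull_triple_iff {a b c x : ℝ × ℝ} :
    x ∈ convexHull ℝ ({a, b, c} : Set (ℝ × ℝ)) ↔
      ∃ u v w : ℝ, 0 ≤ u ∧ 0 ≤ v ∧ 0 ≤ w ∧ u + v + w = 1 ∧ u • a + v • b + w • c = x := by
  rw [convexHull_insert (by simp), convexHull_pair]
  simp only [convexJoin_singleton_left, Set.mem_iUnion, segment, Set.mem_ofPred_eq, exists_prop]
  constructor
  · rintro ⟨_, ⟨s, t, hs, ht, hst, rfl⟩, u, v, hu, hv, huv, rfl⟩
    refine ⟨u, v * s, v * t, hu, by positivity, by positivity, ?_, ?_⟩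
    · rw [add_assoc, ← mul_add, hst, mul_one, huv]
    · rw [smul_add, smul_smul, smul_smul, add_assoc]
  · rintro ⟨u, v, w, hu, hv, hw, h, rfl⟩
    by_cases h0 : v + w = 0
    · have hv0 : v = 0 := by linarith
      have hw0 : w = 0 := by linarith
      exact ⟨b, ⟨1, 0, zero_le_one, le_rfl, by simp, by simp⟩, u, 0, hu, le_rfl, by linarith,
        by simp [hv0, hw0]⟩
    · refine ⟨(v / (v + w)) • b + (w / (v + w)) • c,
        ⟨v / (v + w), w / (v + w), by positivity, by positivity, by field_simp, rfl⟩,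
        u, v + w, hu, by positivity, by linarith, ?_⟩
      rw [smul_add, smul_smul, smul_smul, mul_div_cancel₀ _ h0, mul_div_cancel₀ _ h0, add_assoc]

/-- A point off the three side lines of a triangle lies in it iff it is on the same side of the
three cyclically oriented side lines. -/
theorem mem_convexHull_triple_iff_cross {a b c x : ℝ × ℝ} (hab : cross a b x ≠ 0)
    (hbc : cross b c x ≠ 0) (hca : cross c a x ≠ 0) :
    x ∈ convexHull ℝ ({a, b, c} : Set (ℝ × ℝ)) ↔
      ((0 < cross a b x ↔ 0 < cross b c x) ∧ (0 < cross b c x ↔ 0 < cross c a x)) := by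
  have hsum : cross a b x + cross b c x + cross c a x = cross a b c := by
    unfold cross; ring
  rw [mem_convexHull_triple_iff]
  constructor
  · rintro ⟨u, v, w, hu, hv, hw, h, hx⟩
    obtain rfl : u = 1 - v - w := by linarith
    have h1 : cross a b x = w * cross a b c := by
      rw [← hx]; simp [cross]; ring
    have h2 : cross b c x = (1 - v - w) * cross a b c := by
      rw [← hx]; simp [cross]; ring
    have h3 : cross c a x = v * cross a b c := by
      rw [← hx]; simp [cross]; ring
    have pos : ∀ {r s : ℝ}, 0 ≤ r → r * s ≠ 0 → (0 < r * s ↔ 0 < s) := fun hr hrs =>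
      mul_pos_iff_of_pos_left (lt_of_le_of_ne hr (left_ne_zero_of_mul hrs).symm)
    rw [h1] at hab
    rw [h2] at hbc
    rw [h3] at hca
    rw [h1, h2, h3, pos hw hab, pos hu hbc, pos hv hca]
    simp
  · rintro ⟨h1, h2⟩
    have hD : cross a b c ≠ 0 ∧ 0 ≤ cross a b x / cross a b c ∧
        0 ≤ cross b c x / cross a b c ∧ 0 ≤ cross c a x / cross a b c := by
      rcases lt_or_gt_of_ne hab with h | h
      · have h' : cross b c x < 0 := lt_of_le_of_ne (not_lt.1 fun k => h.not_gt (h1.2 k)) hbc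
        have h'' : cross c a x < 0 := lt_of_le_of_ne (not_lt.1 fun k => h'.not_gt (h2.2 k)) hca
        have hD : cross a b c < 0 := by linarith
        exact ⟨hD.ne, div_nonneg_of_nonpos h.le hD.le, div_nonneg_of_nonpos h'.le hD.le,
          div_nonneg_of_nonpos h''.le hD.le⟩
      · have h' := h1.1 h
        have h'' := h2.1 h'
        have hD : 0 < cross a b c := by linarith
        exact ⟨hD.ne', by positivity, by positivity, by positivity⟩
    obtain ⟨hD, p1, p2, p3⟩ := hD
    refine ⟨_, _, _, p2, p3, p1, ?_, ?_⟩
    · field_simp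
      linarith
    · apply Prod.ext
      · simp only [Prod.fst_add, Prod.smul_fst, smul_eq_mul]
        field_simp
        unfold cross
        ring
      · simp only [Prod.snd_add, Prod.smul_snd, smul_eq_mul]
        field_simp
        unfold cross
        ring

/-- Carathéodory's theorem for four points of the plane. -/
theorem mem_convexHull_quadruple_iff {a b c d x : ℝ × ℝ} (hab : a ≠ b) (hac : a ≠ c)
    (had : a ≠ d) (hbc : b ≠ c) (hbd : b ≠ d) (hcd : c ≠ d) :
    x ∈ convexHull ℝ ({a, b, c, d} : Set (ℝ × ℝ)) ↔
      x ∈ convexHull ℝ ({a, b, c} : Set (ℝ × ℝ)) ∨ x ∈ convexHull ℝ ({a, b, d} : Set (ℝ × ℝ)) ∨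
      x ∈ convexHull ℝ ({a, c, d} : Set (ℝ × ℝ)) ∨ x ∈ convexHull ℝ ({b, c, d} : Set (ℝ × ℝ)) := by
  classical
  constructor
  · rw [convexHull_eq_union]
    simp only [Set.mem_iUnion, exists_prop]
    rintro ⟨t, hts, hind, hx⟩
    have hcard : t.card ≤ 3 := by
      have h := hind.card_le_finrank_succ
      have h2 := Submodule.finrank_le (vectorSpan ℝ (Set.range ((↑) : t → ℝ × ℝ)))
      simp only [Fintype.card_coe, Module.finrank_prod, Module.finrank_self] at h h2
      omega
    have hmiss : ∃ y ∈ ({a, b, c, d} : Finset (ℝ × ℝ)), y ∉ t := by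
      by_contra! hall
      have := Finset.card_le_card (show ({a, b, c, d} : Finset (ℝ × ℝ)) ⊆ t from hall)
      have h4 : ({a, b, c, d} : Finset (ℝ × ℝ)).card = 4 := by
        rw [Finset.card_insert_of_notMem, Finset.card_insert_of_notMem, Finset.card_pair hcd] <;>
          simp [*]
      omega
    have sub : ∀ y ∉ t, ∀ s : Set (ℝ × ℝ), ({a, b, c, d} : Set (ℝ × ℝ)) ⊆ insert y s →
        x ∈ convexHull ℝ s := by
      intro y hy s hs
      refine convexHull_mono (fun z hz => ?_) hx
      rcases hs (hts hz) with rfl | h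
      · exact absurd hz hy
      · exact h
    obtain ⟨y, hy, hyt⟩ := hmiss
    simp only [Finset.mem_insert, Finset.mem_singleton] at hy
    rcases hy with rfl | rfl | rfl | rfl
    · exact Or.inr (Or.inr (Or.inr (sub _ hyt _ (by grind))))
    · exact Or.inr (Or.inr (Or.inl (sub _ hyt _ (by grind))))
    · exact Or.inr (Or.inl (sub _ hyt _ (by grind)))
    · exact Or.inl (sub _ hyt _ (by grind))
  · rintro (h | h | h | h) <;> exact convexHull_mono (by grind) h

theorem mem_extremePoints_convexHull_insert_iff {s : Set (ℝ × ℝ)} (hfin : s.Finite)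
    {x : ℝ × ℝ} (hx : x ∉ s) :
    x ∈ Set.extremePoints ℝ (convexHull ℝ (insert x s)) ↔ x ∉ convexHull ℝ s := by
  constructor
  · intro h hs
    have hsub : s ⊆ convexHull ℝ (insert x s) \ {x} := fun y hy =>
      ⟨subset_convexHull ℝ _ (Or.inr hy), fun hyx => hx (hyx ▸ hy)⟩
    exact ((convex_convexHull ℝ _).mem_extremePoints_iff_mem_sdiff_convexHull_sdiff.1 h).2
      (convexHull_mono hsub hs)
  · intro hs
    by_contra hext
    have hsub : Set.extremePoints ℝ (convexHull ℝ (insert x s)) ⊆ s := fun y hy =>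
      (extremePoints_convexHull_subset hy).resolve_left fun hyx => hext (hyx ▸ hy)
    have hKM := closure_convexHull_extremePoints ((hfin.insert x).isCompact_convexHull ℝ)
      (convex_convexHull ℝ _)
    have hmem : x ∈ convexHull ℝ (insert x s) := subset_convexHull ℝ _ (Or.inl rfl)
    rw [← hKM] at hmem
    replace hmem := closure_mono (convexHull_mono hsub) hmem
    rw [(hfin.isCompact_convexHull ℝ).isClosed.closure_eq] at hmem
    exact hs hmem

/-- An assignment of a sign to each ordered triple of five labels; `true` stands for positive. -/
abbrev SignMap := Fin 5 → Fin 5 → Fin 5 → Bool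

/-- The alternating sign map with the same values as `f` on increasing triples. -/
def sortedSign (f : SignMap) (i j k : Fin 5) : Bool :=
  if i < j then if j < k then f i j k else if i < k then !f i k j else f k i j
  else if i < k then !f j i k else if j < k then f j k i else !f k j i

/-- The sign map with prescribed values on increasing triples, listed lexicographically. -/
def signTable (b0 b1 b2 b3 b4 b5 b6 b7 b8 b9 : Bool) : SignMap
  | 0, 1, 2 => b0
  | 0, 1, 3 => b1
  | 0, 1, 4 => b2
  | 0, 2, 3 => b3
  | 0, 2, 4 => b4
  | 0, 3, 4 => b5
  | 1, 2, 3 => b6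
  | 1, 2, 4 => b7
  | 1, 3, 4 => b8
  | 2, 3, 4 => b9
  | _, _, _ => true

/-- The sign condition for `x` to lie in the triangle `a b c`. -/
def inTriangle (χ : SignMap) (x a b c : Fin 5) : Bool :=
  χ a b x == χ b c x && χ b c x == χ c a x

/-- The sign condition for four points to be in convex position. -/
def isConvexQuad (χ : SignMap) (a b c d : Fin 5) : Bool :=
  !inTriangle χ a b c d && !inTriangle χ b a c d && !inTriangle χ c a b d && !inTriangle χ d a b c

/-- The sign condition for `x` to be extreme among five points. -/
def isExtremeLabel (χ : SignMap) (x a b c d : Fin 5) : Bool :=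
  !inTriangle χ x a b c && !inTriangle χ x a b d && !inTriangle χ x a c d && !inTriangle χ x b c d

/-- Compatibility of the signs at `a` with the three-term Grassmann–Plücker relation. -/
def plueckerSigns (χ : SignMap) (a b c d e : Fin 5) : Bool :=
  !((χ a b c ^^ χ a d e) == (χ a b e ^^ χ a c d) &&
    ((χ a b c ^^ χ a d e) ^^ (χ a b d ^^ χ a c e)))

/-- Compatibility of the signs of four points with additivity of signed area. -/
def areaSigns (χ : SignMap) (a b c d : Fin 5) : Bool :=
  !(χ a b c == χ a c d && χ a b d == χ b c d && (χ a b c ^^ χ a b d))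

/-- The sign condition for `x`, `y` to be γ-points of `{a, b, c}` in distinct regions. -/
def isGammaDiff (χ : SignMap) (x y a b c : Fin 5) : Bool :=
  isConvexQuad χ x a b c && isConvexQuad χ y a b c &&
    ((χ a b x ^^ χ a b y) || (χ a c x ^^ χ a c y) || (χ b c x ^^ χ b c y))

/-- Number of splittings of the five labels into a pair and a triple such that the pair consists
of γ-points of the triple in distinct regions. -/
def gammaDiffNum (χ : SignMap) : ℕ :=
  (isGammaDiff χ 0 1 2 3 4).toNat + (isGammaDiff χ 0 2 1 3 4).toNat +
  (isGammaDiff χ 0 3 1 2 4).toNat + (isGammaDiff χ 0 4 1 2 3).toNat +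
  (isGammaDiff χ 1 2 0 3 4).toNat + (isGammaDiff χ 1 3 0 2 4).toNat +
  (isGammaDiff χ 1 4 0 2 3).toNat + (isGammaDiff χ 2 3 0 1 4).toNat +
  (isGammaDiff χ 2 4 0 1 3).toNat + (isGammaDiff χ 3 4 0 1 2).toNat

/-- Number of extreme labels. -/
def extremeNum (χ : SignMap) : ℕ :=
  (isExtremeLabel χ 0 1 2 3 4).toNat + (isExtremeLabel χ 1 0 2 3 4).toNat +
  (isExtremeLabel χ 2 0 1 3 4).toNat + (isExtremeLabel χ 3 0 1 2 4).toNat +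
  (isExtremeLabel χ 4 0 1 2 3).toNat

/-- The sign relations satisfied by every five points in general position. -/
def isRealizable (χ : SignMap) : Bool :=
  areaSigns χ 0 1 2 3 && areaSigns χ 0 1 2 4 && areaSigns χ 0 1 3 4 && areaSigns χ 0 2 3 4 &&
  areaSigns χ 1 2 3 4 && plueckerSigns χ 0 1 2 3 4 && plueckerSigns χ 1 0 2 3 4 &&
  plueckerSigns χ 2 0 1 3 4 && plueckerSigns χ 3 0 1 2 4 && plueckerSigns χ 4 0 1 2 3

theorem gammaDiffNum_sortedSign_signTable : ∀ b0 b1 b2 b3 b4 b5 b6 b7 b8 b9 : Bool,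
    isRealizable (sortedSign (signTable b0 b1 b2 b3 b4 b5 b6 b7 b8 b9)) = true →
    gammaDiffNum (sortedSign (signTable b0 b1 b2 b3 b4 b5 b6 b7 b8 b9)) =
      5 * (if extremeNum (sortedSign (signTable b0 b1 b2 b3 b4 b5 b6 b7 b8 b9)) = 5
        then 1 else 0) +
      (if extremeNum (sortedSign (signTable b0 b1 b2 b3 b4 b5 b6 b7 b8 b9)) = 4
        then 1 else 0) := by
  decide +kernel

open scoped Classical in
/-- The orientations of the triples of a family of five points. -/
noncomputable def orientSign (p : Fin 5 → ℝ × ℝ) : SignMap :=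
  sortedSign (signTable
    (decide (0 < cross (p 0) (p 1) (p 2))) (decide (0 < cross (p 0) (p 1) (p 3)))
    (decide (0 < cross (p 0) (p 1) (p 4))) (decide (0 < cross (p 0) (p 2) (p 3)))
    (decide (0 < cross (p 0) (p 2) (p 4))) (decide (0 < cross (p 0) (p 3) (p 4)))
    (decide (0 < cross (p 1) (p 2) (p 3))) (decide (0 < cross (p 1) (p 2) (p 4)))
    (decide (0 < cross (p 1) (p 3) (p 4))) (decide (0 < cross (p 2) (p 3) (p 4))))

/-- No three members of the family are collinear. -/
def NoThreeCollinear (p : Fin 5 → ℝ × ℝ) : Prop :=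
  ∀ i j k, i ≠ j → i ≠ k → j ≠ k → cross (p i) (p j) (p k) ≠ 0

theorem signTable_of_lt (f : SignMap) {i j k : Fin 5} (hij : i < j) (hjk : j < k) :
    signTable (f 0 1 2) (f 0 1 3) (f 0 1 4) (f 0 2 3) (f 0 2 4) (f 0 3 4) (f 1 2 3) (f 1 2 4)
      (f 1 3 4) (f 2 3 4) i j k = f i j k := by
  fin_cases i <;> fin_cases j <;> first | exact absurd hij (by decide) | skip
  all_goals fin_cases k <;> first | exact absurd hjk (by decide) | rfl

theorem orientSign_iff {p : Fin 5 → ℝ × ℝ} (hp : NoThreeCollinear p) {i j k : Fin 5}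
    (hij : i ≠ j) (hik : i ≠ k) (hjk : j ≠ k) :
    orientSign p i j k = true ↔ 0 < cross (p i) (p j) (p k) := by
  classical
  have ht : ∀ {i j k : Fin 5}, i < j → j < k → signTable
    (decide (0 < cross (p 0) (p 1) (p 2))) (decide (0 < cross (p 0) (p 1) (p 3)))
    (decide (0 < cross (p 0) (p 1) (p 4))) (decide (0 < cross (p 0) (p 2) (p 3)))
    (decide (0 < cross (p 0) (p 2) (p 4))) (decide (0 < cross (p 0) (p 3) (p 4)))
    (decide (0 < cross (p 1) (p 2) (p 3))) (decide (0 < cross (p 1) (p 2) (p 4)))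
    (decide (0 < cross (p 1) (p 3) (p 4))) (decide (0 < cross (p 2) (p 3) (p 4))) i j k =
      decide (0 < cross (p i) (p j) (p k)) := fun h h' =>
    signTable_of_lt (fun i j k => decide (0 < cross (p i) (p j) (p k))) h h'
  have swap : ∀ {i j k : Fin 5}, i ≠ j → i ≠ k → j ≠ k →
      (¬ 0 < cross (p i) (p j) (p k) ↔ 0 < cross (p j) (p i) (p k)) := by
    intro i j k h h' h''
    have h0 := hp _ _ _ h h' h''
    rw [cross_swap (p i), neg_pos, not_lt]
    exact ⟨fun hle => lt_of_le_of_ne hle h0, le_of_lt⟩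
  unfold orientSign sortedSign
  split_ifs with h1 h2 h3 h3 h4
  · rw [ht h1 h2, decide_eq_true_iff]
  · rw [ht h3 (by omega), ← decide_not, decide_eq_true_iff, swap hik hij hjk.symm,
      ← cross_rotate]
  · rw [ht (by omega) h1, decide_eq_true_iff, cross_rotate (p k)]
  · rw [ht (by omega) h3, ← decide_not, decide_eq_true_iff, swap hij.symm hjk hik]
  · rw [ht h4 (by omega), decide_eq_true_iff, cross_rotate (p i)]
  · rw [ht (by omega) (by omega), ← decide_not, decide_eq_true_iff,
      swap hjk.symm hik.symm hij.symm, cross_rotate (p i)]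

theorem xor_iff_not_mul_pos {s t : Bool} {x y : ℝ} (hx : x ≠ 0) (hy : y ≠ 0)
    (hs : s = true ↔ 0 < x) (ht : t = true ↔ 0 < y) : (s ^^ t) = true ↔ ¬ 0 < x * y := by
  rcases lt_or_gt_of_ne hx with hx | hx <;> rcases lt_or_gt_of_ne hy with hy | hy <;>
    cases s <;> cases t <;> simp_all [mul_pos_iff]

theorem isRealizable_orientSign {p : Fin 5 → ℝ × ℝ} (hp : NoThreeCollinear p) :
    isRealizable (orientSign p) = true := by
  have harea : ∀ a b c d : Fin 5, [a, b, c, d].Nodup → areaSigns (orientSign p) a b c d := by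
    intro a b c d h
    simp only [List.nodup_cons, List.mem_cons, List.not_mem_nil, or_false, not_or,
      not_false_eq_true, List.nodup_nil, and_true] at h
    obtain ⟨⟨hab, hac, had⟩, ⟨hbc, hbd⟩, hcd⟩ := h
    have e1 := orientSign_iff hp hab hac hbc
    have e2 := orientSign_iff hp hac had hcd
    have e3 := orientSign_iff hp hab had hbd
    have e4 := orientSign_iff hp hbc hbd hcd
    have n1 := hp _ _ _ hab hac hbc
    have n2 := hp _ _ _ hac had hcd
    have n3 := hp _ _ _ hab had hbd
    have n4 := hp _ _ _ hbc hbd hcd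
    have hsum : cross (p a) (p b) (p c) + cross (p a) (p c) (p d) =
        cross (p a) (p b) (p d) + cross (p b) (p c) (p d) := by
      unfold cross; ring
    unfold areaSigns
    generalize orientSign p a b c = s1 at *
    generalize orientSign p a c d = s2 at *
    generalize orientSign p a b d = s3 at *
    generalize orientSign p b c d = s4 at *
    generalize cross (p a) (p b) (p c) = r1 at *
    generalize cross (p a) (p c) (p d) = r2 at *
    generalize cross (p a) (p b) (p d) = r3 at *
    generalize cross (p b) (p c) (p d) = r4 at *
    cases s1 <;> cases s2 <;> cases s3 <;> cases s4 <;> first | rfl | (exfalso; simp at *; linarith)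
  have hpl : ∀ a b c d e : Fin 5, [a, b, c, d, e].Nodup →
      plueckerSigns (orientSign p) a b c d e := by
    intro a b c d e h
    simp only [List.nodup_cons, List.mem_cons, List.not_mem_nil, or_false, not_or,
      not_false_eq_true, List.nodup_nil, and_true] at h
    obtain ⟨⟨hab, hac, had, hae⟩, ⟨hbc, hbd, hbe⟩, ⟨hcd, hce⟩, hde⟩ := h
    have e1 := xor_iff_not_mul_pos (hp _ _ _ hab hac hbc) (hp _ _ _ had hae hde)
      (orientSign_iff hp hab hac hbc) (orientSign_iff hp had hae hde)
    have e2 := xor_iff_not_mul_pos (hp _ _ _ hab hae hbe) (hp _ _ _ hac had hcd)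
      (orientSign_iff hp hab hae hbe) (orientSign_iff hp hac had hcd)
    have e3 := xor_iff_not_mul_pos (hp _ _ _ hab had hbd) (hp _ _ _ hac hae hce)
      (orientSign_iff hp hab had hbd) (orientSign_iff hp hac hae hce)
    have n1 := mul_ne_zero (hp _ _ _ hab hac hbc) (hp _ _ _ had hae hde)
    have n3 := mul_ne_zero (hp _ _ _ hab had hbd) (hp _ _ _ hac hae hce)
    have hsum : cross (p a) (p b) (p c) * cross (p a) (p d) (p e) +
        cross (p a) (p b) (p e) * cross (p a) (p c) (p d) =
        cross (p a) (p b) (p d) * cross (p a) (p c) (p e) := by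
      unfold cross; ring
    unfold plueckerSigns
    generalize (orientSign p a b c ^^ orientSign p a d e) = s1 at *
    generalize (orientSign p a b e ^^ orientSign p a c d) = s2 at *
    generalize (orientSign p a b d ^^ orientSign p a c e) = s3 at *
    generalize cross (p a) (p b) (p c) * cross (p a) (p d) (p e) = r1 at *
    generalize cross (p a) (p b) (p e) * cross (p a) (p c) (p d) = r2 at *
    generalize cross (p a) (p b) (p d) * cross (p a) (p c) (p e) = r3 at *
    clear hp
    cases s1 <;> cases s2 <;> cases s3 <;> first | rfl | (exfalso; simp at *; grind)
  unfold isRealizable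
  rw [harea 0 1 2 3 (by decide), harea 0 1 2 4 (by decide), harea 0 1 3 4 (by decide),
    harea 0 2 3 4 (by decide), harea 1 2 3 4 (by decide), hpl 0 1 2 3 4 (by decide),
    hpl 1 0 2 3 4 (by decide), hpl 2 0 1 3 4 (by decide), hpl 3 0 1 2 4 (by decide),
    hpl 4 0 1 2 3 (by decide)]
  rfl

theorem NoThreeCollinear.injective {p : Fin 5 → ℝ × ℝ} (hp : NoThreeCollinear p) :
    Function.Injective p := by
  intro i j hij
  by_contra hne
  obtain ⟨k, hki, hkj⟩ : ∃ k, i ≠ k ∧ j ≠ k := by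
    clear hij hp
    revert i j
    decide
  refine hp i j k hne hki hkj ?_
  rw [hij]
  unfold cross
  ring

theorem inTriangle_iff {p : Fin 5 → ℝ × ℝ} (hp : NoThreeCollinear p) {x a b c : Fin 5}
    (h : [x, a, b, c].Nodup) :
    inTriangle (orientSign p) x a b c = true ↔
      p x ∈ convexHull ℝ ({p a, p b, p c} : Set (ℝ × ℝ)) := by
  simp only [List.nodup_cons, List.mem_cons, List.not_mem_nil, or_false, not_or,
    not_false_eq_true, List.nodup_nil, and_true] at h
  obtain ⟨⟨hxa, hxb, hxc⟩, ⟨hab, hac⟩, hbc⟩ := h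
  rw [mem_convexHull_triple_iff_cross (hp _ _ _ hab (Ne.symm hxa) (Ne.symm hxb))
    (hp _ _ _ hbc (Ne.symm hxb) (Ne.symm hxc)) (hp _ _ _ (Ne.symm hac) (Ne.symm hxc) (Ne.symm hxa)),
    ← orientSign_iff hp hab (Ne.symm hxa) (Ne.symm hxb),
    ← orientSign_iff hp hbc (Ne.symm hxb) (Ne.symm hxc),
    ← orientSign_iff hp (Ne.symm hac) (Ne.symm hxc) (Ne.symm hxa),
    ← Bool.eq_iff_iff, ← Bool.eq_iff_iff]
  simp [inTriangle]

theorem isConvexQuad_iff {p : Fin 5 → ℝ × ℝ} (hp : NoThreeCollinear p) {x a b c : Fin 5}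
    (h : [x, a, b, c].Nodup) :
    isConvexQuad (orientSign p) x a b c = true ↔ ConvexPos {p x, p a, p b, p c} := by
  have key : ∀ {x a b c : Fin 5}, [x, a, b, c].Nodup →
      ((!inTriangle (orientSign p) x a b c) = true ↔
        p x ∈ Set.extremePoints ℝ (convexHull ℝ ({p x, p a, p b, p c} : Set (ℝ × ℝ)))) := by
    intro x a b c h
    rw [mem_extremePoints_convexHull_insert_iff (Set.toFinite _), ← inTriangle_iff hp h]
    · simp
    · simp only [Set.mem_insert_iff, Set.mem_singleton_iff, hp.injective.eq_iff]
      simp only [List.nodup_cons, List.mem_cons, List.not_mem_nil, or_false] at h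
      exact h.1
  have e1 := key h
  have e2 := key (x := a) (a := x) (b := b) (c := c) (by grind)
  have e3 := key (x := b) (a := x) (b := a) (c := c) (by grind)
  have e4 := key (x := c) (a := x) (b := a) (c := b) (by grind)
  have s2 : ({p a, p x, p b, p c} : Set (ℝ × ℝ)) = {p x, p a, p b, p c} := by grind
  have s3 : ({p b, p x, p a, p c} : Set (ℝ × ℝ)) = {p x, p a, p b, p c} := by grind
  have s4 : ({p c, p x, p a, p b} : Set (ℝ × ℝ)) = {p x, p a, p b, p c} := by grind
  rw [s2] at e2
  rw [s3] at e3
  rw [s4] at e4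
  simp only [isConvexQuad, Bool.and_eq_true, e1, e2, e3, e4, ConvexPos, Finset.mem_insert,
    Finset.mem_singleton, forall_eq_or_imp, forall_eq, Finset.coe_insert, Finset.coe_singleton,
    and_assoc]

theorem isExtremeLabel_iff {p : Fin 5 → ℝ × ℝ} (hp : NoThreeCollinear p) {x a b c d : Fin 5}
    (h : [x, a, b, c, d].Nodup) :
    isExtremeLabel (orientSign p) x a b c d = true ↔
      p x ∈ Set.extremePoints ℝ (convexHull ℝ ({p x, p a, p b, p c, p d} : Set (ℝ × ℝ))) := by
  have ht1 := inTriangle_iff hp (x := x) (a := a) (b := b) (c := c) (by grind)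
  have ht2 := inTriangle_iff hp (x := x) (a := a) (b := b) (c := d) (by grind)
  have ht3 := inTriangle_iff hp (x := x) (a := a) (b := c) (c := d) (by grind)
  have ht4 := inTriangle_iff hp (x := x) (a := b) (b := c) (c := d) (by grind)
  simp only [List.nodup_cons, List.mem_cons, List.not_mem_nil, or_false, not_or,
    not_false_eq_true, List.nodup_nil, and_true] at h
  obtain ⟨⟨hxa, hxb, hxc, hxd⟩, ⟨hab, hac, had⟩, ⟨hbc, hbd⟩, hcd⟩ := h
  have inj := hp.injective
  rw [mem_extremePoints_convexHull_insert_iff (Set.toFinite _) (by simp [inj.eq_iff, *]),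
    mem_convexHull_quadruple_iff (inj.ne hab) (inj.ne hac) (inj.ne had) (inj.ne hbc) (inj.ne hbd)
      (inj.ne hcd), ← ht1, ← ht2, ← ht3, ← ht4]
  simp [isExtremeLabel, and_assoc]

theorem sameSide_iff {p : Fin 5 → ℝ × ℝ} (hp : NoThreeCollinear p) {x y a b : Fin 5}
    (hab : a ≠ b) (hax : a ≠ x) (hbx : b ≠ x) (hay : a ≠ y) (hby : b ≠ y) :
    SameSide (p a) (p b) (p x) (p y) ↔ (orientSign p a b x ^^ orientSign p a b y) = false := by
  rw [← Bool.not_eq_true, xor_iff_not_mul_pos (hp _ _ _ hab hax hbx) (hp _ _ _ hab hay hby)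
    (orientSign_iff hp hab hax hbx) (orientSign_iff hp hab hay hby), not_not]
  rfl

theorem SameSide.swap {p q x y : ℝ × ℝ} (h : SameSide p q x y) : SameSide q p x y := by
  change 0 < cross q p x * cross q p y
  rw [cross_swap, cross_swap p q y, neg_mul_neg]
  exact h

theorem SameSide.symm {p q x y : ℝ × ℝ} (h : SameSide p q x y) : SameSide p q y x := by
  unfold SameSide at *
  rwa [mul_comm]

theorem sameRegion_triple_iff {a b c x y : ℝ × ℝ} (hab : a ≠ b) (hac : a ≠ c) (hbc : b ≠ c) :
    SameRegion {a, b, c} x y ↔ SameSide a b x y ∧ SameSide a c x y ∧ SameSide b c x y := by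
  constructor
  · intro h
    exact ⟨h a (by simp) b (by simp) hab, h a (by simp) c (by simp) hac,
      h b (by simp) c (by simp) hbc⟩
  · rintro ⟨h1, h2, h3⟩ p hp q hq hpq
    simp only [Finset.mem_insert, Finset.mem_singleton] at hp hq
    rcases hp with rfl | rfl | rfl <;> rcases hq with rfl | rfl | rfl <;>
      first
      | exact absurd rfl hpq
      | assumption
      | exact SameSide.swap (by assumption)

/-- The pairs counted by `gammaDiffPairs`. -/
def IsGammaDiffPair (T S : Finset (ℝ × ℝ)) : Prop :=
  (∀ x ∈ S, IsGammaPt T x) ∧ ∀ x ∈ S, ∀ y ∈ S, x ≠ y → ¬ SameRegion T x y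

theorem isGammaDiff_iff {p : Fin 5 → ℝ × ℝ} (hp : NoThreeCollinear p) {x y a b c : Fin 5}
    (h : [x, y, a, b, c].Nodup) :
    IsGammaDiffPair {p a, p b, p c} {p x, p y} ↔
      isGammaDiff (orientSign p) x y a b c = true := by
  have hx := isConvexQuad_iff hp (x := x) (a := a) (b := b) (c := c) (by grind)
  have hy := isConvexQuad_iff hp (x := y) (a := a) (b := b) (c := c) (by grind)
  simp only [List.nodup_cons, List.mem_cons, List.not_mem_nil, or_false, not_or,
    not_false_eq_true, List.nodup_nil, and_true] at h
  obtain ⟨⟨hxy, hxa, hxb, hxc⟩, ⟨hya, hyb, hyc⟩, ⟨hab, hac⟩, hbc⟩ := h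
  have inj := hp.injective
  have hsymm : SameRegion {p a, p b, p c} (p y) (p x) ↔ SameRegion {p a, p b, p c} (p x) (p y) :=
    ⟨fun h u hu v hv huv => (h u hu v hv huv).symm, fun h u hu v hv huv => (h u hu v hv huv).symm⟩
  have hreg := sameRegion_triple_iff (x := p x) (y := p y) (inj.ne hab) (inj.ne hac) (inj.ne hbc)
  rw [sameSide_iff hp hab (Ne.symm hxa) (Ne.symm hxb) (Ne.symm hya) (Ne.symm hyb),
    sameSide_iff hp hac (Ne.symm hxa) (Ne.symm hxc) (Ne.symm hya) (Ne.symm hyc),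
    sameSide_iff hp hbc (Ne.symm hxb) (Ne.symm hxc) (Ne.symm hyb) (Ne.symm hyc)] at hreg
  have hpair : (∀ u ∈ ({p x, p y} : Finset (ℝ × ℝ)), ∀ v ∈ ({p x, p y} : Finset (ℝ × ℝ)), u ≠ v →
      ¬ SameRegion {p a, p b, p c} u v) ↔ ¬ SameRegion {p a, p b, p c} (p x) (p y) := by
    simp [inj.eq_iff, hxy, Ne.symm hxy, hsymm]
  unfold IsGammaDiffPair isGammaDiff
  have hgamma : (∀ u ∈ ({p x, p y} : Finset (ℝ × ℝ)), IsGammaPt {p a, p b, p c} u) ↔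
      ConvexPos {p x, p a, p b, p c} ∧ ConvexPos {p y, p a, p b, p c} := by
    simp only [Finset.mem_insert, Finset.mem_singleton, forall_eq_or_imp, forall_eq, IsGammaPt]
  rw [hpair, hreg, hgamma, ← hx, ← hy]
  generalize (orientSign p a b x ^^ orientSign p a b y) = s1
  generalize (orientSign p a c x ^^ orientSign p a c y) = s2
  generalize (orientSign p b c x ^^ orientSign p b c y) = s3
  cases s1 <;> cases s2 <;> cases s3 <;> simp

open scoped Classical in
theorem card_isGammaDiffPair {p : Fin 5 → ℝ × ℝ} (hp : NoThreeCollinear p) :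
    (((univ.image p).powersetCard 2).filter fun S => IsGammaDiffPair (univ.image p \ S) S).card =
      gammaDiffNum (orientSign p) := by
  have inj := hp.injective
  have hpairs : (univ : Finset (Fin 5)).powersetCard 2 =
      {{0, 1}, {0, 2}, {0, 3}, {0, 4}, {1, 2}, {1, 3}, {1, 4}, {2, 3}, {2, 4}, {3, 4}} := by
    decide
  have hterm : ∀ {x y a b c : Fin 5}, [x, y, a, b, c].Nodup →
      (univ : Finset (Fin 5)) \ {x, y} = {a, b, c} →
      (if IsGammaDiffPair (univ.image p \ ({x, y} : Finset (Fin 5)).image p)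
        (({x, y} : Finset (Fin 5)).image p) then 1 else 0) =
      (isGammaDiff (orientSign p) x y a b c).toNat := by
    intro x y a b c h hc
    rw [← Finset.image_sdiff _ _ inj, hc]
    simp only [Finset.image_insert, Finset.image_singleton, isGammaDiff_iff hp h]
    cases isGammaDiff (orientSign p) x y a b c <;> simp
  have himage : (univ.image p).powersetCard 2 =
      ((univ : Finset (Fin 5)).powersetCard 2).image (Finset.image p) := by
    have hmap := Finset.powersetCard_map ⟨p, inj⟩ 2 univ
    rw [Finset.map_eq_image, Finset.map_eq_image] at hmap
    rw [show univ.image p = univ.image (⟨p, inj⟩ : Fin 5 ↪ ℝ × ℝ) from rfl, hmap]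
    refine Finset.image_congr fun S _ => ?_
    exact Finset.map_eq_image _ _
  rw [Finset.card_filter, himage, Finset.sum_image (Finset.image_injective inj).injOn, hpairs]
  iterate 9 rw [Finset.sum_insert (by decide)]
  rw [Finset.sum_singleton,
    hterm (a := 2) (b := 3) (c := 4) (by decide) (by decide),
    hterm (a := 1) (b := 3) (c := 4) (by decide) (by decide),
    hterm (a := 1) (b := 2) (c := 4) (by decide) (by decide),
    hterm (a := 1) (b := 2) (c := 3) (by decide) (by decide),
    hterm (a := 0) (b := 3) (c := 4) (by decide) (by decide),
    hterm (a := 0) (b := 2) (c := 4) (by decide) (by decide),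
    hterm (a := 0) (b := 2) (c := 3) (by decide) (by decide),
    hterm (a := 0) (b := 1) (c := 4) (by decide) (by decide),
    hterm (a := 0) (b := 1) (c := 3) (by decide) (by decide),
    hterm (a := 0) (b := 1) (c := 2) (by decide) (by decide)]
  unfold gammaDiffNum
  ring

theorem ncard_extremePoints {p : Fin 5 → ℝ × ℝ} (hp : NoThreeCollinear p) :
    (Set.extremePoints ℝ (convexHull ℝ ((univ.image p : Finset (ℝ × ℝ)) : Set (ℝ × ℝ)))).ncard =
      extremeNum (orientSign p) := by
  classical
  have inj := hp.injective
  set E := Set.extremePoints ℝ (convexHull ℝ ((univ.image p : Finset (ℝ × ℝ)) : Set (ℝ × ℝ)))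
    with hE
  have hsub : E = ((univ.filter fun i => p i ∈ E).image p : Finset (ℝ × ℝ)) := by
    ext x
    simp only [Finset.coe_image, Finset.coe_filter, Finset.mem_univ, true_and, Set.mem_image,
      Set.mem_ofPred_eq]
    constructor
    · intro hx
      have hx' := extremePoints_convexHull_subset hx
      simp only [Finset.coe_image, Finset.coe_univ, Set.image_univ, Set.mem_range] at hx'
      obtain ⟨i, rfl⟩ := hx'
      exact ⟨i, hx, rfl⟩
    · rintro ⟨i, hi, rfl⟩
      exact hi
  have hterm : ∀ {x a b c d : Fin 5}, [x, a, b, c, d].Nodup → univ = {x, a, b, c, d} →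
      (if p x ∈ E then 1 else 0) = (isExtremeLabel (orientSign p) x a b c d).toNat := by
    intro x a b c d h hu
    have hset : ((univ.image p : Finset (ℝ × ℝ)) : Set (ℝ × ℝ)) = {p x, p a, p b, p c, p d} := by
      rw [hu]
      simp
    rw [hE, hset]
    simp only [← isExtremeLabel_iff hp h]
    cases isExtremeLabel (orientSign p) x a b c d <;> simp
  rw [hsub, Set.ncard_coe_finset, Finset.card_image_of_injective _ inj, Finset.card_filter,
    Fin.sum_univ_five,
    hterm (a := 1) (b := 2) (c := 3) (d := 4) (by decide) (by decide),
    hterm (a := 0) (b := 2) (c := 3) (d := 4) (by decide) (by decide),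
    hterm (a := 0) (b := 1) (c := 3) (d := 4) (by decide) (by decide),
    hterm (a := 0) (b := 1) (c := 2) (d := 4) (by decide) (by decide),
    hterm (a := 0) (b := 1) (c := 2) (d := 3) (by decide) (by decide)]
  rfl

open scoped Classical in
theorem card_isGammaDiffPair_eq {P F : Finset (ℝ × ℝ)} (hgp : GenPos P)
    (hF : F ∈ P.powersetCard 5) :
    ((F.powersetCard 2).filter fun S => IsGammaDiffPair (F \ S) S).card =
      5 * (if (Set.extremePoints ℝ (convexHull ℝ (F : Set (ℝ × ℝ)))).ncard = 5 then 1 else 0) +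
      (if (Set.extremePoints ℝ (convexHull ℝ (F : Set (ℝ × ℝ)))).ncard = 4 then 1 else 0) := by
  obtain ⟨hFP, hcard⟩ := Finset.mem_powersetCard.1 hF
  let e := (F.equivFinOfCardEq hcard).symm
  let p : Fin 5 → ℝ × ℝ := fun i => e i
  have hinj : Function.Injective p := Subtype.val_injective.comp e.injective
  have himage : univ.image p = F := by
    ext x
    simp only [Finset.mem_image, Finset.mem_univ, true_and]
    exact ⟨fun ⟨i, hi⟩ => hi ▸ (e i).2, fun hx => ⟨e.symm ⟨x, hx⟩, by simp [p]⟩⟩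
  have hp : NoThreeCollinear p := fun i j k hij hik hjk h0 =>
    hgp _ (hFP (e i).2) _ (hFP (e j).2) _ (hFP (e k).2) (hinj.ne hij) (hinj.ne hik) (hinj.ne hjk)
      (collinear_of_cross_eq_zero (hinj.ne hij) h0)
  rw [← himage, card_isGammaDiffPair hp, ncard_extremePoints hp]
  exact gammaDiffNum_sortedSign_signTable _ _ _ _ _ _ _ _ _ _ (isRealizable_orientSign hp)

open scoped Classical in
/-- Choosing a triple and then a disjoint pair amounts to choosing five points and then a pair
among them. -/
theorem sum_card_filter_powersetCard_sdiff {α : Type*} (P : Finset α) (k l : ℕ)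
    (Q : Finset α → Finset α → Prop) :
    ∑ T ∈ P.powersetCard k, (((P \ T).powersetCard l).filter fun S => Q T S).card =
      ∑ F ∈ P.powersetCard (k + l), ((F.powersetCard l).filter fun S => Q (F \ S) S).card := by
  rw [← Finset.card_sigma, ← Finset.card_sigma]
  refine Finset.card_bij' (fun z _ => ⟨z.1 ∪ z.2, z.2⟩) (fun z _ => ⟨z.1 \ z.2, z.2⟩) ?_ ?_ ?_ ?_
  · rintro ⟨T, S⟩ h
    simp only [Finset.mem_sigma, Finset.mem_powersetCard, Finset.mem_filter] at h ⊢
    obtain ⟨⟨hT, hTc⟩, ⟨hS, hSc⟩, hQ⟩ := h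
    have hd : Disjoint T S := (Finset.subset_sdiff.1 hS).2.symm
    refine ⟨⟨Finset.union_subset hT (hS.trans Finset.sdiff_subset), ?_⟩,
      ⟨Finset.subset_union_right, hSc⟩, ?_⟩
    · rw [Finset.card_union_of_disjoint hd, hTc, hSc]
    · rwa [Finset.union_sdiff_cancel_right hd]
  · rintro ⟨F, S⟩ h
    simp only [Finset.mem_sigma, Finset.mem_powersetCard, Finset.mem_filter] at h ⊢
    obtain ⟨⟨hF, hFc⟩, ⟨hS, hSc⟩, hQ⟩ := h
    refine ⟨⟨Finset.sdiff_subset.trans hF, ?_⟩, ⟨?_, hSc⟩, hQ⟩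
    · rw [Finset.card_sdiff_of_subset hS, hFc, hSc, Nat.add_sub_cancel]
    · exact Finset.subset_sdiff.2 ⟨hS.trans hF, Finset.disjoint_sdiff⟩
  · rintro ⟨T, S⟩ h
    simp only [Finset.mem_sigma, Finset.mem_powersetCard, Finset.mem_filter] at h
    rw [Finset.union_sdiff_cancel_right (Finset.subset_sdiff.1 h.2.1.1).2.symm]
  · rintro ⟨F, S⟩ h
    simp only [Finset.mem_sigma, Finset.mem_powersetCard, Finset.mem_filter] at h
    rw [Finset.sdiff_union_of_subset h.2.1.1]

open scoped Classical in
theorem hullCount_eq_card_filter (P : Finset (ℝ × ℝ)) (k j : ℕ) :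
    hullCount P k j = ((P.powersetCard k).filter fun F : Finset (ℝ × ℝ) =>
      (Set.extremePoints ℝ (convexHull ℝ (F : Set (ℝ × ℝ)))).ncard = j).card := by
  symm
  unfold hullCount
  refine Finset.card_bij (fun F _ => (F : Set (ℝ × ℝ))) ?_
    (fun F _ G _ h => Finset.coe_injective h) ?_
  · intro F hF
    rw [Finset.mem_filter] at hF ⊢
    exact ⟨by simpa using Finset.mem_powersetCard.1 hF.1, hF.2⟩
  · intro S hS
    rw [Finset.mem_filter] at hS
    obtain ⟨hS, hj⟩ := hS
    simp only [Finset.bind_def, Finset.pure_def, Finset.mem_sup, Finset.mem_singleton] at hS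
    obtain ⟨F, hF, rfl⟩ := hS
    exact ⟨F, Finset.mem_filter.2 ⟨hF, hj⟩, rfl⟩

/-- The sum over 3-element subsets `T` of `P` of the number of pairs of γ-points of `T`
lying in distinct regions with respect to `T` equals `5·P₅(P) + U(P)`. -/
theorem sum_gamma_diff_region_pairs (P : Finset (ℝ × ℝ)) (n : ℕ) (hgp : GenPos P)
    (hcard : P.card = n) :
    ∑ T ∈ P.powersetCard 3, gammaDiffPairs P T =
      5 * hullCount P 5 5 + hullCount P 5 4 := by
  classical
  calc ∑ T ∈ P.powersetCard 3, gammaDiffPairs P T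
      = ∑ T ∈ P.powersetCard 3,
          (((P \ T).powersetCard 2).filter fun S => IsGammaDiffPair T S).card := by
        refine Finset.sum_congr rfl fun T _ => ?_
        unfold gammaDiffPairs
        congr!
    _ = ∑ F ∈ P.powersetCard 5,
          ((F.powersetCard 2).filter fun S => IsGammaDiffPair (F \ S) S).card := by
        convert sum_card_filter_powersetCard_sdiff P 3 2 IsGammaDiffPair
    _ = 5 * hullCount P 5 5 + hullCount P 5 4 := by
        rw [hullCount_eq_card_filter, hullCount_eq_card_filter,
          Finset.sum_congr rfl fun F hF => card_isGammaDiffPair_eq hgp hF,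
          Finset.sum_add_distrib, ← Finset.mul_sum, ← Finset.card_filter, ← Finset.card_filter]
end

section
/- For any point placement P of n points, the sum over all 3-element subsets T of P of the number of 2-element subsets {x, y} ⊆ P \ T such that x and y are both β-points of T lying in the same region with respect to T equals U(P) + 2·T₂(P). -/
open Finset

/-- Twice the signed area of the triangle `p q r`. -/
def signedArea (p q r : ℝ × ℝ) : ℝ :=
  (q.1 - p.1) * (r.2 - p.2) - (q.2 - p.2) * (r.1 - p.1)

lemma signedArea_ne_zero {P : Finset (ℝ × ℝ)} (hP : GenPos P) {p q r : ℝ × ℝ}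
    (hp : p ∈ P) (hq : q ∈ P) (hr : r ∈ P) (hpq : p ≠ q) (hpr : p ≠ r) (hqr : q ≠ r) :
    signedArea p q r ≠ 0 := by
  intro h
  refine hP p hp q hq r hr hpq hpr hqr ?_
  rw [collinear_iff_of_mem (p₀ := p) (by simp)]
  refine ⟨q - p, ?_⟩
  obtain ⟨p1, p2⟩ := p
  obtain ⟨q1, q2⟩ := q
  obtain ⟨r1, r2⟩ := r
  simp only [signedArea] at h
  have hr : ∃ t : ℝ, r1 = t * (q1 - p1) + p1 ∧ r2 = t * (q2 - p2) + p2 := by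
    by_cases h1 : q1 - p1 = 0
    · have h2 : q2 - p2 ≠ 0 := by
        intro h2
        exact hpq (Prod.ext (by simp; linarith) (by simp; linarith))
      refine ⟨(r2 - p2) / (q2 - p2), ?_, by field_simp; ring⟩
      rw [h1] at h ⊢
      have : r1 - p1 = 0 := by
        have : (q2 - p2) * (r1 - p1) = 0 := by linarith
        exact (mul_eq_zero.mp this).resolve_left h2
      linarith
    · refine ⟨(r1 - p1) / (q1 - p1), by field_simp; ring, ?_⟩
      field_simp
      linarith
  obtain ⟨t, h1, h2⟩ := hr
  intro x hx
  simp only [Set.mem_insert_iff, Set.mem_singleton_iff] at hx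
  rcases hx with rfl | rfl | rfl
  · exact ⟨0, by simp⟩
  · exact ⟨1, by simp⟩
  · exact ⟨t, by simp [h1, h2]⟩

/-- `p` sees the vertices `a`, `b`, `c` in strict cyclic order. -/
def InTriangle (p a b c : ℝ × ℝ) : Prop :=
  (0 < signedArea p a b ∧ 0 < signedArea p b c ∧ 0 < signedArea p c a) ∨
    (signedArea p a b < 0 ∧ signedArea p b c < 0 ∧ signedArea p c a < 0)

lemma mem_convexHull_triple_iff_s11 {p a b c : ℝ × ℝ} (hab : signedArea p a b ≠ 0)
    (hbc : signedArea p b c ≠ 0) (hca : signedArea p c a ≠ 0) :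
    p ∈ convexHull ℝ ({a, b, c} : Set (ℝ × ℝ)) ↔ InTriangle p a b c := by
  constructor
  · intro h
    rw [convexHull_insert (by simp), convexHull_pair] at h
    simp only [convexJoin_singleton_left, Set.mem_iUnion] at h
    obtain ⟨w, ⟨s, t, hs, ht, hst, rfl⟩, ⟨u, v, hu, hv, huv, rfl⟩⟩ := h
    obtain ⟨a1, a2⟩ := a
    obtain ⟨b1, b2⟩ := b
    obtain ⟨c1, c2⟩ := c
    obtain rfl : u = 1 - v := by linarith
    obtain rfl : s = 1 - t := by linarith
    set D := signedArea (a1, a2) (b1, b2) (c1, c2) with hD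
    set p := (1 - v) • (a1, a2) + v • ((1 - t) • (b1, b2) + t • (c1, c2)) with hp
    have e1 : signedArea p (a1, a2) (b1, b2) = (v * t) * D := by
      simp [signedArea, hp, hD]; ring
    have e2 : signedArea p (b1, b2) (c1, c2) = (1 - v) * D := by
      simp [signedArea, hp, hD]; ring
    have e3 : signedArea p (c1, c2) (a1, a2) = (v * (1 - t)) * D := by
      simp [signedArea, hp, hD]; ring
    rw [e1] at hab
    rw [e2] at hbc
    rw [e3] at hca
    unfold InTriangle
    rw [e1, e2, e3]
    have k1 : 0 < v * t := lt_of_le_of_ne (by positivity) (Ne.symm (left_ne_zero_of_mul hab))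
    have k2 : 0 < 1 - v := lt_of_le_of_ne hu (Ne.symm (left_ne_zero_of_mul hbc))
    have k3 : 0 < v * (1 - t) :=
      lt_of_le_of_ne (by positivity) (Ne.symm (left_ne_zero_of_mul hca))
    rcases lt_or_gt_of_ne (right_ne_zero_of_mul hab) with h | h
    · right
      exact ⟨mul_neg_of_pos_of_neg k1 h, mul_neg_of_pos_of_neg k2 h, mul_neg_of_pos_of_neg k3 h⟩
    · left
      exact ⟨mul_pos k1 h, mul_pos k2 h, mul_pos k3 h⟩
  · intro h
    set D := signedArea p a b + signedArea p b c + signedArea p c a with hD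
    have hD0 : D ≠ 0 := by
      rcases h with ⟨h1, h2, h3⟩ | ⟨h1, h2, h3⟩
      · exact (by linarith : 0 < D).ne'
      · exact (by linarith : D < 0).ne
    have hp : p = (signedArea p b c / D) • a + (signedArea p c a / D) • b +
        (signedArea p a b / D) • c := by
      ext
      · simp; field_simp; simp only [hD, signedArea]; ring
      · simp; field_simp; simp only [hD, signedArea]; ring
    have hsum : signedArea p b c / D + signedArea p c a / D + signedArea p a b / D = 1 := by
      field_simp; rw [hD]; ring
    have hw : 0 ≤ signedArea p b c / D ∧ 0 ≤ signedArea p c a / D ∧ 0 ≤ signedArea p a b / D := by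
      rcases h with ⟨h1, h2, h3⟩ | ⟨h1, h2, h3⟩
      · have : 0 < D := by linarith
        refine ⟨?_, ?_, ?_⟩ <;> positivity
      · have : D < 0 := by linarith
        exact ⟨div_nonneg_of_nonpos h2.le this.le, div_nonneg_of_nonpos h3.le this.le,
          div_nonneg_of_nonpos h1.le this.le⟩
    obtain ⟨w1, w2, w3⟩ := hw
    generalize signedArea p b c / D = α at *
    generalize signedArea p c a / D = β at *
    generalize signedArea p a b / D = γ at *
    rw [hp]
    have hS := convex_convexHull ℝ ({a, b, c} : Set (ℝ × ℝ))
    have := hS.sum_mem (t := Finset.univ) (w := ![α, β, γ]) (z := ![a, b, c])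
      (by intro i _; fin_cases i <;> simpa) (by simp [Fin.sum_univ_three, hsum])
      (by intro i _; fin_cases i <;> exact subset_convexHull ℝ _ (by simp))
    simpa [Fin.sum_univ_three] using this

lemma mem_extremePoints_convexHull_iff {S : Finset (ℝ × ℝ)} {p : ℝ × ℝ} (hp : p ∈ S) :
    p ∈ Set.extremePoints ℝ (convexHull ℝ (S : Set (ℝ × ℝ))) ↔
      p ∉ convexHull ℝ ((S.erase p : Finset (ℝ × ℝ)) : Set (ℝ × ℝ)) := by
  constructor
  · intro h h'
    rw [(convex_convexHull ℝ _).mem_extremePoints_iff_mem_sdiff_convexHull_sdiff] at h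
    refine h.2 (convexHull_mono ?_ h')
    intro x hx
    rw [Finset.mem_coe, Finset.mem_erase] at hx
    exact ⟨subset_convexHull ℝ _ hx.2, hx.1⟩
  · intro h
    by_contra h'
    apply h
    have hK := closure_convexHull_extremePoints (S.finite_toSet.isCompact_convexHull ℝ)
      (convex_convexHull ℝ (S : Set (ℝ × ℝ)))
    have hsub : Set.extremePoints ℝ (convexHull ℝ (S : Set (ℝ × ℝ))) ⊆
        ((S.erase p : Finset (ℝ × ℝ)) : Set (ℝ × ℝ)) := by
      intro x hx
      rw [Finset.mem_coe, Finset.mem_erase]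
      refine ⟨?_, extremePoints_convexHull_subset hx⟩
      rintro rfl
      exact h' hx
    have hcl := (S.erase p).finite_toSet.isClosed_convexHull ℝ
    have : p ∈ convexHull ℝ (S : Set (ℝ × ℝ)) := subset_convexHull ℝ _ hp
    rw [← hK] at this
    exact hcl.closure_subset_iff.mpr (convexHull_mono hsub) this

lemma exists_triple_of_mem_convexHull {R : Finset (ℝ × ℝ)} (hR : 3 ≤ R.card) {p : ℝ × ℝ}
    (hp : p ∈ convexHull ℝ (R : Set (ℝ × ℝ))) :
    ∃ U ⊆ R, U.card = 3 ∧ p ∈ convexHull ℝ (U : Set (ℝ × ℝ)) := by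
  rw [convexHull_eq_union] at hp
  simp only [Set.mem_iUnion] at hp
  obtain ⟨t, htR, hai, hpt⟩ := hp
  have hc := hai.card_le_finrank_succ
  have hfr : Module.finrank ℝ (vectorSpan ℝ (Set.range ((↑) : t → ℝ × ℝ))) ≤ 2 := by
    refine (Submodule.finrank_le _).trans ?_
    simp
  rw [Fintype.card_coe] at hc
  obtain ⟨U, htU, hUR, hU⟩ := Finset.exists_subsuperset_card_eq (Finset.coe_subset.mp htR)
    (hc.trans (Nat.succ_le_succ hfr)) hR
  exact ⟨U, hUR, hU, convexHull_mono (Finset.coe_subset.mpr htU) hpt⟩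

lemma three_le_card_extreme {P Q : Finset (ℝ × ℝ)} (hP : GenPos P) (hQP : Q ⊆ P)
    (hQ : 3 ≤ Q.card) :
    3 ≤ (Set.extremePoints ℝ (convexHull ℝ (Q : Set (ℝ × ℝ)))).ncard := by
  by_contra! hlt
  have hsub : Set.extremePoints ℝ (convexHull ℝ (Q : Set (ℝ × ℝ))) ⊆ (Q : Set (ℝ × ℝ)) :=
    extremePoints_convexHull_subset
  have hfin := Q.finite_toSet.subset hsub
  have hE : hfin.toFinset ⊆ Q := by
    intro x hx
    exact hsub (hfin.mem_toFinset.mp hx)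
  rw [Set.ncard_eq_toFinset_card _ hfin] at hlt
  obtain ⟨E, hE1, hE2, hE3⟩ := Finset.exists_subsuperset_card_eq (n := 2) hE (by omega) (by omega)
  obtain ⟨z, hzQ, hzE⟩ := Finset.exists_mem_notMem_of_card_lt_card (s := E) (t := Q) (by omega)
  obtain ⟨u, v, huv, rfl⟩ := Finset.card_eq_two.mp hE3
  have hK := closure_convexHull_extremePoints (Q.finite_toSet.isCompact_convexHull ℝ)
    (convex_convexHull ℝ (Q : Set (ℝ × ℝ)))
  have hz : z ∈ convexHull ℝ (Q : Set (ℝ × ℝ)) := subset_convexHull ℝ _ hzQ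
  have hcl := (Finset.finite_toSet ({u, v} : Finset (ℝ × ℝ))).isClosed_convexHull ℝ
  rw [← hK] at hz
  have hz' := hcl.closure_subset_iff.mpr (convexHull_mono (fun x hx =>
    hE1 (hfin.mem_toFinset.mpr hx))) hz
  have hz'' := convexHull_subset_affineSpan _ hz'
  simp only [Finset.coe_pair] at hz''
  simp only [Finset.mem_insert, Finset.mem_singleton, not_or] at hzE
  exact hP z (hQP hzQ) u (hQP (hE2 (by simp))) v (hQP (hE2 (by simp))) hzE.1 hzE.2 huv
    (collinear_insert_of_mem_affineSpan_pair hz'')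

lemma mem_convexHull_triple_iff_of_genPos {P : Finset (ℝ × ℝ)} (hP : GenPos P)
    {p a b c : ℝ × ℝ} (hp : p ∈ P) (ha : a ∈ P) (hb : b ∈ P) (hc : c ∈ P)
    (hpa : p ≠ a) (hpb : p ≠ b) (hpc : p ≠ c) (hab : a ≠ b) (hac : a ≠ c) (hbc : b ≠ c) :
    p ∈ convexHull ℝ ({a, b, c} : Set (ℝ × ℝ)) ↔ InTriangle p a b c :=
  mem_convexHull_triple_iff_s11 (signedArea_ne_zero hP hp ha hb hpa hpb hab)
    (signedArea_ne_zero hP hp hb hc hpb hpc hbc) (signedArea_ne_zero hP hp hc ha hpc hpa hac.symm)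

lemma signedArea_swap (p a b : ℝ × ℝ) : signedArea p b a = -signedArea p a b := by
  simp only [signedArea]; ring

/-- If `p` lies in the triangle `a b c`, then for every further point `d` it lies in exactly one
of the triangles spanned by `d` and an edge of `a b c`. -/
lemma InTriangle.exists_unique_replace {p a b c d : ℝ × ℝ} (h : InTriangle p a b c)
    (ha : signedArea p a d ≠ 0) (hb : signedArea p b d ≠ 0) (hc : signedArea p c d ≠ 0) :
    (InTriangle p a b d ∧ ¬ InTriangle p b c d ∧ ¬ InTriangle p c a d) ∨
    (¬ InTriangle p a b d ∧ InTriangle p b c d ∧ ¬ InTriangle p c a d) ∨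
    (¬ InTriangle p a b d ∧ ¬ InTriangle p b c d ∧ InTriangle p c a d) := by
  have key : signedArea p a b * signedArea p c d + signedArea p b c * signedArea p a d +
      signedArea p c a * signedArea p b d = 0 := by
    simp only [signedArea]; ring
  unfold InTriangle at *
  rw [signedArea_swap p a d, signedArea_swap p b d, signedArea_swap p c d]
  generalize signedArea p a b = ab at *
  generalize signedArea p b c = bc at *
  generalize signedArea p c a = ca at *
  generalize signedArea p a d = ad at *
  generalize signedArea p b d = bd at *
  generalize signedArea p c d = cd at *
  have excl {x y z u v w : ℝ} (hx : 0 < x) (hy : 0 < y) (hz : 0 < z) (hu : 0 < u) (hv : 0 < v)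
      (hw : 0 < w) (h : x * w + y * u + z * v = 0) : False := by
    have : 0 < x * w + y * u + z * v := by positivity
    exact this.ne' h
  rcases h with ⟨h1, h2, h3⟩ | ⟨h1, h2, h3⟩ <;>
  rcases lt_or_gt_of_ne ha with ha | ha <;>
  rcases lt_or_gt_of_ne hb with hb | hb <;>
  rcases lt_or_gt_of_ne hc with hc | hc <;>
  first
  | (simp [h1, h2, h3, ha, hb, hc, h1.le, h2.le, h3.le, ha.le, hb.le, hc.le]; done)
  | exact (excl h1 h2 h3 ha hb hc (by linarith)).elim
  | exact (excl h1 h2 h3 (neg_pos.mpr ha) (neg_pos.mpr hb) (neg_pos.mpr hc) (by linarith)).elim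
  | exact (excl (neg_pos.mpr h1) (neg_pos.mpr h2) (neg_pos.mpr h3) ha hb hc (by linarith)).elim
  | exact (excl (neg_pos.mpr h1) (neg_pos.mpr h2) (neg_pos.mpr h3) (neg_pos.mpr ha)
      (neg_pos.mpr hb) (neg_pos.mpr hc) (by linarith)).elim

open scoped Classical in
/-- The points of `R` whose removal keeps `p` in the convex hull. -/
noncomputable def removable (R : Finset (ℝ × ℝ)) (p : ℝ × ℝ) : Finset (ℝ × ℝ) :=
  R.filter fun y => p ∈ convexHull ℝ ((R.erase y : Finset (ℝ × ℝ)) : Set (ℝ × ℝ))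

lemma mem_removable {R : Finset (ℝ × ℝ)} {p y : ℝ × ℝ} :
    y ∈ removable R p ↔
      y ∈ R ∧ p ∈ convexHull ℝ ((R.erase y : Finset (ℝ × ℝ)) : Set (ℝ × ℝ)) := by
  simp [removable]

lemma card_removable {P R : Finset (ℝ × ℝ)} (hP : GenPos P) {p : ℝ × ℝ} (hp : p ∈ P)
    (hRP : R ⊆ P) (hR : R.card = 4) (hpR : p ∉ R)
    (h : p ∈ convexHull ℝ (R : Set (ℝ × ℝ))) : (removable R p).card = 2 := by
  obtain ⟨U, hUR, hU, hpU⟩ := exists_triple_of_mem_convexHull (by omega) h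
  obtain ⟨d, hdR, hdU⟩ := Finset.exists_mem_notMem_of_card_lt_card (s := U) (t := R) (by omega)
  have hRU : R = insert d U := (Finset.eq_of_subset_of_card_le
    (Finset.insert_subset hdR hUR) (by rw [Finset.card_insert_of_notMem hdU]; omega)).symm
  obtain ⟨a, b, c, hab, hac, hbc, rfl⟩ := Finset.card_eq_three.mp hU
  simp only [Finset.mem_insert, Finset.mem_singleton, not_or, ← ne_eq] at hdU
  obtain ⟨hda, hdb, hdc⟩ := hdU
  subst hRU
  simp only [Finset.mem_insert, Finset.mem_singleton, not_or, ← ne_eq] at hpR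
  obtain ⟨hpd, hpa, hpb, hpc⟩ := hpR
  have ha : a ∈ P := hRP (by simp)
  have hb : b ∈ P := hRP (by simp)
  have hc : c ∈ P := hRP (by simp)
  have hd : d ∈ P := hRP (by simp)
  have ed : (({d, a, b, c} : Finset (ℝ × ℝ)).erase d : Set (ℝ × ℝ)) = {a, b, c} := by
    ext x; simp; grind
  have ec : (({d, a, b, c} : Finset (ℝ × ℝ)).erase c : Set (ℝ × ℝ)) = {a, b, d} := by
    ext x; simp; grind
  have ea : (({d, a, b, c} : Finset (ℝ × ℝ)).erase a : Set (ℝ × ℝ)) = {b, c, d} := by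
    ext x; simp; grind
  have eb : (({d, a, b, c} : Finset (ℝ × ℝ)).erase b : Set (ℝ × ℝ)) = {c, a, d} := by
    ext x; simp; grind
  simp only [Finset.coe_insert, Finset.coe_singleton] at hpU
  have hd' := hpU
  rw [mem_convexHull_triple_iff_of_genPos hP hp ha hb hc hpa hpb hpc hab hac hbc] at hpU
  have hcases := hpU.exists_unique_replace (signedArea_ne_zero hP hp ha hd hpa hpd hda.symm)
    (signedArea_ne_zero hP hp hb hd hpb hpd hdb.symm)
    (signedArea_ne_zero hP hp hc hd hpc hpd hdc.symm)
  rw [← mem_convexHull_triple_iff_of_genPos hP hp ha hb hd hpa hpb hpd hab hda.symm hdb.symm,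
    ← mem_convexHull_triple_iff_of_genPos hP hp hb hc hd hpb hpc hpd hbc hdb.symm hdc.symm,
    ← mem_convexHull_triple_iff_of_genPos hP hp hc ha hd hpc hpa hpd hac.symm hdc.symm hda.symm] at hcases
  have md := mem_removable (R := {d, a, b, c}) (p := p) (y := d)
  have ma := mem_removable (R := {d, a, b, c}) (p := p) (y := a)
  have mb := mem_removable (R := {d, a, b, c}) (p := p) (y := b)
  have mc := mem_removable (R := {d, a, b, c}) (p := p) (y := c)
  rw [ed] at md
  rw [ea] at ma
  rw [eb] at mb
  rw [ec] at mc
  simp only [hd', Finset.mem_insert, Finset.mem_singleton, true_or, or_true, true_and,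
    iff_true] at md ma mb mc
  rw [← ma, ← mb, ← mc] at hcases
  have hsub (x : ℝ × ℝ) (hx : x ∈ removable {d, a, b, c} p) : x = d ∨ x = a ∨ x = b ∨ x = c := by
    simpa using (mem_removable.mp hx).1
  rw [Finset.card_eq_two]
  rcases hcases with ⟨h1, h2, h3⟩ | ⟨h1, h2, h3⟩ | ⟨h1, h2, h3⟩
  · exact ⟨d, c, hdc, by ext x; rw [Finset.mem_insert, Finset.mem_singleton]; grind⟩
  · exact ⟨d, a, hda, by ext x; rw [Finset.mem_insert, Finset.mem_singleton]; grind⟩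
  · exact ⟨d, b, hdb, by ext x; rw [Finset.mem_insert, Finset.mem_singleton]; grind⟩

/-- The position of a point with respect to the sides of a triangle `p q r`, when `p` lies in
the triangle spanned by it and `q`, `r`. -/
lemma InTriangle.signs {p q r x : ℝ × ℝ} (h : InTriangle p x q r) :
    (0 < signedArea p q r ∧ signedArea p q x < 0 ∧ 0 < signedArea p r x ∧
      0 < signedArea q r x) ∨
    (signedArea p q r < 0 ∧ 0 < signedArea p q x ∧ signedArea p r x < 0 ∧
      signedArea q r x < 0) := by
  have e : signedArea q r x = signedArea p q r + signedArea p r x - signedArea p q x := by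
    simp only [signedArea]; ring
  rw [e]
  unfold InTriangle at h
  rw [signedArea_swap p q x] at h
  rcases h with ⟨h1, h2, h3⟩ | ⟨h1, h2, h3⟩
  · exact Or.inl ⟨by linarith, by linarith, by linarith, by linarith⟩
  · exact Or.inr ⟨by linarith, by linarith, by linarith, by linarith⟩

/-- `x` lies in the region of `T` beyond the vertex `p`. -/
def BeyondVertex (T : Finset (ℝ × ℝ)) (p x : ℝ × ℝ) : Prop :=
  p ∈ convexHull ℝ ((insert x (T.erase p) : Finset (ℝ × ℝ)) : Set (ℝ × ℝ))

lemma exists_eq_triple_of_mem {T : Finset (ℝ × ℝ)} (hT : T.card = 3) {p : ℝ × ℝ} (hp : p ∈ T) :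
    ∃ q r, p ≠ q ∧ p ≠ r ∧ q ≠ r ∧ T = {p, q, r} ∧ T.erase p = {q, r} := by
  have h2 : (T.erase p).card = 2 := by rw [Finset.card_erase_of_mem hp, hT]
  obtain ⟨q, r, hqr, he⟩ := Finset.card_eq_two.mp h2
  have hq : q ∈ T.erase p := by simp [he]
  have hr : r ∈ T.erase p := by simp [he]
  refine ⟨q, r, (Finset.ne_of_mem_erase hq).symm, (Finset.ne_of_mem_erase hr).symm, hqr, ?_, he⟩
  rw [← Finset.insert_erase hp, he]

section

variable {P T : Finset (ℝ × ℝ)} {x y p q r : ℝ × ℝ}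

lemma BeyondVertex.inTriangle (h : BeyondVertex T p x) (hP : GenPos P) (hx : x ∈ P)
    (hxT : x ∉ T) (hTP : T ⊆ P) (hpq : p ≠ q) (hpr : p ≠ r) (hqr : q ≠ r)
    (hT : T = {p, q, r}) : InTriangle p x q r := by
  subst hT
  simp only [Finset.mem_insert, Finset.mem_singleton, not_or, ← ne_eq] at hxT
  obtain ⟨hxp, hxq, hxr⟩ := hxT
  have e : ((insert x (({p, q, r} : Finset (ℝ × ℝ)).erase p) : Finset (ℝ × ℝ)) : Set (ℝ × ℝ)) =
      {x, q, r} := by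
    rw [Finset.erase_insert (by simp [hpq, hpr])]
    simp
  unfold BeyondVertex at h
  rw [e] at h
  exact (mem_convexHull_triple_iff_of_genPos hP (hTP (by simp)) hx (hTP (by simp))
    (hTP (by simp)) hxp.symm hpq hpr hxq hxr hqr).mp h

lemma isBetaPt_iff (hP : GenPos P) (hTP : T ⊆ P) (hT : T.card = 3) (hx : x ∈ P) (hxT : x ∉ T) :
    IsBetaPt T x ↔ ∃ p ∈ T, BeyondVertex T p x := by
  constructor
  · rintro ⟨h1, h2⟩
    unfold ConvexPos at h1
    push Not at h1
    obtain ⟨p, hp, hpe⟩ := h1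
    rw [mem_extremePoints_convexHull_iff hp, not_not] at hpe
    have hxp : x ≠ p := by
      rintro rfl
      rw [Finset.erase_insert hxT] at hpe
      exact h2 hpe
    refine ⟨p, (Finset.mem_insert.mp hp).resolve_left hxp.symm, ?_⟩
    rwa [Finset.erase_insert_of_ne hxp] at hpe
  · rintro ⟨p, hp, h⟩
    have hxp : x ≠ p := by rintro rfl; exact hxT hp
    refine ⟨fun hc => ?_, fun hc => ?_⟩
    · have := hc p (Finset.mem_insert_of_mem hp)
      rw [mem_extremePoints_convexHull_iff (Finset.mem_insert_of_mem hp),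
        Finset.erase_insert_of_ne hxp] at this
      exact this h
    · obtain ⟨q, r, hpq, hpr, hqr, hTe, -⟩ := exists_eq_triple_of_mem hT hp
      have hs := (h.inTriangle hP hx hxT hTP hpq hpr hqr hTe).signs
      subst hTe
      simp only [Finset.mem_insert, Finset.mem_singleton, not_or, ← ne_eq] at hxT
      obtain ⟨-, hxq, hxr⟩ := hxT
      simp only [Finset.coe_insert, Finset.coe_singleton] at hc
      rw [mem_convexHull_triple_iff_of_genPos hP hx (hTP (by simp)) (hTP (by simp))
        (hTP (by simp)) hxp hxq hxr hpq hpr hqr] at hc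
      have e1 : signedArea x p q = signedArea p q x := by simp only [signedArea]; ring
      have e2 : signedArea x q r = signedArea q r x := by simp only [signedArea]; ring
      have e3 : signedArea x r p = -signedArea p r x := by simp only [signedArea]; ring
      unfold InTriangle at hc
      rw [e1, e2, e3] at hc
      rcases hs with ⟨h1, h2, h3, h4⟩ | ⟨h1, h2, h3, h4⟩ <;>
        rcases hc with ⟨h5, h6, h7⟩ | ⟨h5, h6, h7⟩ <;> linarith

lemma sameSide_iff_s11 {u v : ℝ × ℝ} :
    SameSide u v x y ↔ 0 < signedArea u v x * signedArea u v y := Iff.rfl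

lemma sameSide_comm {u v : ℝ × ℝ} : SameSide u v x y ↔ SameSide v u x y := by
  rw [sameSide_iff_s11, sameSide_iff_s11]
  have e (z : ℝ × ℝ) : signedArea v u z = -signedArea u v z := by simp only [signedArea]; ring
  rw [e, e, neg_mul_neg]

lemma BeyondVertex.sameRegion (hP : GenPos P) (hTP : T ⊆ P) (hT : T.card = 3) (hp : p ∈ T)
    (hx : x ∈ P) (hxT : x ∉ T) (hy : y ∈ P) (hyT : y ∉ T)
    (h1 : BeyondVertex T p x) (h2 : BeyondVertex T p y) : SameRegion T x y := by
  obtain ⟨q, r, hpq, hpr, hqr, hTe, -⟩ := exists_eq_triple_of_mem hT hp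
  have hs1 := (h1.inTriangle hP hx hxT hTP hpq hpr hqr hTe).signs
  have hs2 := (h2.inTriangle hP hy hyT hTP hpq hpr hqr hTe).signs
  have k : SameSide p q x y ∧ SameSide p r x y ∧ SameSide q r x y := by
    simp only [sameSide_iff_s11]
    rcases hs1 with ⟨a1, a2, a3, a4⟩ | ⟨a1, a2, a3, a4⟩ <;>
      rcases hs2 with ⟨b1, b2, b3, b4⟩ | ⟨b1, b2, b3, b4⟩
    · exact ⟨mul_pos_of_neg_of_neg a2 b2, mul_pos a3 b3, mul_pos a4 b4⟩
    · linarith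
    · linarith
    · exact ⟨mul_pos a2 b2, mul_pos_of_neg_of_neg a3 b3, mul_pos_of_neg_of_neg a4 b4⟩
  obtain ⟨k1, k2, k3⟩ := k
  subst hTe
  intro u hu v hv huv
  simp only [Finset.mem_insert, Finset.mem_singleton] at hu hv
  rcases hu with rfl | rfl | rfl <;> rcases hv with rfl | rfl | rfl <;>
    first | exact (huv rfl).elim | assumption | (rw [sameSide_comm]; assumption)

lemma BeyondVertex.eq_of_sameRegion (hP : GenPos P) (hTP : T ⊆ P) (hT : T.card = 3)
    (hp : p ∈ T) (hq : q ∈ T) (hx : x ∈ P) (hxT : x ∉ T) (hy : y ∈ P) (hyT : y ∉ T)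
    (h1 : BeyondVertex T p x) (h2 : BeyondVertex T q y) (h : SameRegion T x y) : p = q := by
  by_contra hpq
  obtain ⟨q', r', hpq', hpr', hqr', hTe', hTer⟩ := exists_eq_triple_of_mem hT hp
  obtain ⟨r, hpr, hqr, hTe⟩ : ∃ r, p ≠ r ∧ q ≠ r ∧ T = {p, q, r} := by
    have : q ∈ T.erase p := Finset.mem_erase.mpr ⟨Ne.symm hpq, hq⟩
    rw [hTer, Finset.mem_insert, Finset.mem_singleton] at this
    rcases this with rfl | rfl
    · exact ⟨r', hpr', hqr', hTe'⟩
    · exact ⟨q', hpq', hqr'.symm, by rw [hTe', Finset.pair_comm]⟩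
  have hs1 := (h1.inTriangle hP hx hxT hTP hpq hpr hqr hTe).signs
  have hs2 := (h2.inTriangle hP hy hyT hTP (Ne.symm hpq) hqr hpr
    (by rw [hTe, Finset.insert_comm])).signs
  have k1 := h p hp q hq hpq
  have k2 := h q hq r (by simp [hTe]) hqr
  rw [sameSide_iff_s11] at k1 k2
  have e (z : ℝ × ℝ) : signedArea q p z = -signedArea p q z := by simp only [signedArea]; ring
  rw [e, e] at hs2
  rcases hs1 with ⟨a1, a2, a3, a4⟩ | ⟨a1, a2, a3, a4⟩ <;>
    rcases hs2 with ⟨b1, b2, b3, b4⟩ | ⟨b1, b2, b3, b4⟩ <;>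
    nlinarith

end

open scoped Classical in
/-- The points of `Q` that are not extreme points of its convex hull. -/
noncomputable def nonextreme (Q : Finset (ℝ × ℝ)) : Finset (ℝ × ℝ) :=
  Q.filter fun p => p ∈ convexHull ℝ ((Q.erase p : Finset (ℝ × ℝ)) : Set (ℝ × ℝ))

lemma mem_nonextreme {Q : Finset (ℝ × ℝ)} {p : ℝ × ℝ} :
    p ∈ nonextreme Q ↔
      p ∈ Q ∧ p ∈ convexHull ℝ ((Q.erase p : Finset (ℝ × ℝ)) : Set (ℝ × ℝ)) := by
  simp [nonextreme]

lemma ncard_extremePoints_add_card_nonextreme (Q : Finset (ℝ × ℝ)) :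
    (Set.extremePoints ℝ (convexHull ℝ (Q : Set (ℝ × ℝ)))).ncard + (nonextreme Q).card =
      Q.card := by
  have h : Set.extremePoints ℝ (convexHull ℝ (Q : Set (ℝ × ℝ))) =
      ((Q \ nonextreme Q : Finset (ℝ × ℝ)) : Set (ℝ × ℝ)) := by
    ext x
    rw [Finset.mem_coe, Finset.mem_sdiff, mem_nonextreme]
    constructor
    · intro hx
      have hxQ : x ∈ Q := extremePoints_convexHull_subset hx
      exact ⟨hxQ, fun h => (mem_extremePoints_convexHull_iff hxQ).mp hx h.2⟩
    · rintro ⟨hxQ, hx⟩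
      exact (mem_extremePoints_convexHull_iff hxQ).mpr fun h => hx ⟨hxQ, h⟩
  rw [h, Set.ncard_coe_finset]
  exact Finset.card_sdiff_add_card_eq_card fun x hx => (mem_nonextreme.mp hx).1

lemma forall_beyondVertex_iff {T S : Finset (ℝ × ℝ)} (hTS : Disjoint T S) (hS : S.card = 2)
    {p : ℝ × ℝ} (hp : p ∈ T) :
    (∀ x ∈ S, BeyondVertex T p x) ↔ S ⊆ removable ((T ∪ S).erase p) p := by
  obtain ⟨u, v, huv, rfl⟩ := Finset.card_eq_two.mp hS
  have hu : u ∉ T := Finset.disjoint_right.mp hTS (by simp)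
  have hv : v ∉ T := Finset.disjoint_right.mp hTS (by simp)
  have hup : u ≠ p := by rintro rfl; exact hu hp
  have hvp : v ≠ p := by rintro rfl; exact hv hp
  have e1 : ((T ∪ {u, v}).erase p).erase v = insert u (T.erase p) := by
    ext x; simp only [Finset.mem_erase, Finset.mem_union, Finset.mem_insert,
      Finset.mem_singleton]; grind
  have e2 : ((T ∪ {u, v}).erase p).erase u = insert v (T.erase p) := by
    ext x; simp only [Finset.mem_erase, Finset.mem_union, Finset.mem_insert,
      Finset.mem_singleton]; grind
  simp only [Finset.insert_subset_iff, Finset.singleton_subset_iff, mem_removable, e1, e2]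
  simp [BeyondVertex, hup, hvp, and_comm]

lemma beta_sameRegion_iff {P T S : Finset (ℝ × ℝ)} (hP : GenPos P) (hTP : T ⊆ P)
    (hT : T.card = 3) (hSP : S ⊆ P \ T) (hS : S.card = 2) :
    ((∀ x ∈ S, IsBetaPt T x) ∧ ∀ x ∈ S, ∀ y ∈ S, x ≠ y → SameRegion T x y) ↔
      ∃ p ∈ T, ∀ x ∈ S, BeyondVertex T p x := by
  have hmem {x : ℝ × ℝ} (hx : x ∈ S) : x ∈ P ∧ x ∉ T := Finset.mem_sdiff.mp (hSP hx)
  constructor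
  · rintro ⟨hβ, hreg⟩
    obtain ⟨x, hx⟩ : S.Nonempty := Finset.card_pos.mp (by omega)
    obtain ⟨hxP, hxT⟩ := hmem hx
    obtain ⟨p, hp, hpx⟩ := (isBetaPt_iff hP hTP hT hxP hxT).mp (hβ x hx)
    refine ⟨p, hp, fun y hy => ?_⟩
    rcases eq_or_ne x y with rfl | hxy
    · exact hpx
    obtain ⟨hyP, hyT⟩ := hmem hy
    obtain ⟨q, hq, hqy⟩ := (isBetaPt_iff hP hTP hT hyP hyT).mp (hβ y hy)
    rwa [hpx.eq_of_sameRegion hP hTP hT hp hq hxP hxT hyP hyT hqy (hreg x hx y hy hxy)]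
  · rintro ⟨p, hp, h⟩
    refine ⟨fun x hx => ?_, fun x hx y hy _ => ?_⟩
    · obtain ⟨hxP, hxT⟩ := hmem hx
      exact (isBetaPt_iff hP hTP hT hxP hxT).mpr ⟨p, hp, h x hx⟩
    · obtain ⟨hxP, hxT⟩ := hmem hx
      obtain ⟨hyP, hyT⟩ := hmem hy
      exact (h x hx).sameRegion hP hTP hT hp hxP hxT hyP hyT (h y hy)

/-- The points of a five-point set that can be split off from a nonextreme point `p`, together
with the remaining triangle. -/
lemma removable_spec {P Q : Finset (ℝ × ℝ)} (hP : GenPos P) (hQP : Q ⊆ P) (hQ : Q.card = 5)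
    {p : ℝ × ℝ} (hp : p ∈ nonextreme Q) :
    removable (Q.erase p) p ⊆ Q ∧ (removable (Q.erase p) p).card = 2 ∧
      (Q \ removable (Q.erase p) p).card = 3 ∧ p ∈ Q \ removable (Q.erase p) p ∧
      ∀ x ∈ removable (Q.erase p) p, BeyondVertex (Q \ removable (Q.erase p) p) p x := by
  obtain ⟨hpQ, hpc⟩ := mem_nonextreme.mp hp
  have h2 : (removable (Q.erase p) p).card = 2 :=
    card_removable hP (hQP hpQ) ((Finset.erase_subset _ _).trans hQP)
      (by rw [Finset.card_erase_of_mem hpQ, hQ]) (Finset.notMem_erase _ _) hpc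
  have hsub : removable (Q.erase p) p ⊆ Q := fun x hx =>
    Finset.mem_of_mem_erase (mem_removable.mp hx).1
  have hpT : p ∈ Q \ removable (Q.erase p) p := Finset.mem_sdiff.mpr
    ⟨hpQ, fun h => Finset.notMem_erase _ _ (mem_removable.mp h).1⟩
  refine ⟨hsub, h2, by rw [Finset.card_sdiff_of_subset hsub]; omega, hpT, ?_⟩
  rw [forall_beyondVertex_iff Finset.sdiff_disjoint h2 hpT, Finset.sdiff_union_of_subset hsub]

lemma sum_betaSamePairs_eq {P : Finset (ℝ × ℝ)} (hP : GenPos P) :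
    ∑ T ∈ P.powersetCard 3, betaSamePairs P T =
      ∑ Q ∈ P.powersetCard 5, (nonextreme Q).card := by
  classical
  unfold betaSamePairs
  rw [← Finset.card_sigma, ← Finset.card_sigma]
  symm
  refine Finset.card_bij
    (fun a _ => ⟨a.1 \ removable (a.1.erase a.2) a.2, removable (a.1.erase a.2) a.2⟩) ?_ ?_ ?_
  · rintro ⟨Q, p⟩ ha
    simp only [Finset.mem_sigma, Finset.mem_powersetCard] at ha
    obtain ⟨⟨hQP, hQ⟩, hp⟩ := ha
    obtain ⟨h1, h2, h3, h4, h5⟩ := removable_spec hP hQP hQ hp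
    have hSP : removable (Q.erase p) p ⊆ P \ (Q \ removable (Q.erase p) p) := fun x hx =>
      Finset.mem_sdiff.mpr ⟨hQP (h1 hx), fun h => (Finset.mem_sdiff.mp h).2 hx⟩
    have hTP : Q \ removable (Q.erase p) p ⊆ P := Finset.sdiff_subset.trans hQP
    simp only [Finset.mem_sigma, Finset.mem_powersetCard, Finset.mem_filter]
    exact ⟨⟨hTP, h3⟩, ⟨hSP, h2⟩, (beta_sameRegion_iff hP hTP h3 hSP h2).mpr ⟨p, h4, h5⟩⟩
  · rintro ⟨Q, p⟩ ha ⟨Q', p'⟩ ha' heq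
    simp only [Finset.mem_sigma, Finset.mem_powersetCard] at ha ha'
    obtain ⟨⟨hQP, hQ⟩, hp⟩ := ha
    obtain ⟨⟨hQP', hQ'⟩, hp'⟩ := ha'
    obtain ⟨h1, h2, h3, h4, h5⟩ := removable_spec hP hQP hQ hp
    obtain ⟨h1', h2', h3', h4', h5'⟩ := removable_spec hP hQP' hQ' hp'
    simp only [Sigma.mk.injEq, heq_eq_eq] at heq
    obtain ⟨e1, e2⟩ := heq
    have hQQ : Q = Q' := by
      rw [← Finset.sdiff_union_of_subset h1, ← Finset.sdiff_union_of_subset h1', e1, e2]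
    rw [← e1] at h4' h5'
    rw [← e2] at h5'
    obtain ⟨x, hx⟩ : (removable (Q.erase p) p).Nonempty := Finset.card_pos.mp (by omega)
    have hTP : Q \ removable (Q.erase p) p ⊆ P := Finset.sdiff_subset.trans hQP
    have hxP := hQP (h1 hx)
    have hxT : x ∉ Q \ removable (Q.erase p) p := fun h => (Finset.mem_sdiff.mp h).2 hx
    have hpp := (h5 x hx).eq_of_sameRegion hP hTP h3 h4 h4' hxP hxT hxP hxT (h5' x hx)
      ((h5 x hx).sameRegion hP hTP h3 h4 hxP hxT hxP hxT (h5 x hx))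
    rw [hQQ, hpp]
  · rintro ⟨T, S⟩ hb
    simp only [Finset.mem_sigma, Finset.mem_powersetCard, Finset.mem_filter] at hb
    obtain ⟨⟨hTP, hT⟩, ⟨hSP, hS⟩, hc⟩ := hb
    obtain ⟨p, hp, h⟩ := (beta_sameRegion_iff hP hTP hT hSP hS).mp hc
    have hTS : Disjoint T S := (Finset.subset_sdiff.mp hSP).2.symm
    rw [forall_beyondVertex_iff hTS hS hp] at h
    have hQP : T ∪ S ⊆ P := Finset.union_subset hTP (Finset.subset_sdiff.mp hSP).1
    have hQ : (T ∪ S).card = 5 := by rw [Finset.card_union_of_disjoint hTS, hT, hS]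
    have hpn : p ∈ nonextreme (T ∪ S) := by
      refine mem_nonextreme.mpr ⟨Finset.mem_union_left _ hp, ?_⟩
      obtain ⟨x, hx⟩ : S.Nonempty := Finset.card_pos.mp (by omega)
      exact convexHull_mono (Finset.coe_subset.mpr (Finset.erase_subset _ _))
        (mem_removable.mp (h hx)).2
    have hSe : S = removable ((T ∪ S).erase p) p :=
      Finset.eq_of_subset_of_card_le h (by rw [(removable_spec hP hQP hQ hpn).2.1, hS])
    refine ⟨⟨T ∪ S, p⟩, ?_, ?_⟩
    · exact Finset.mem_sigma.mpr ⟨Finset.mem_powersetCard.mpr ⟨hQP, hQ⟩, hpn⟩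
    · simp only [← hSe, Finset.union_sdiff_cancel_right hTS]

open scoped Classical in
/-- The filter in `hullCount` runs over the images of the subsets in `Set (ℝ × ℝ)`; counting the
finsets themselves gives the same number. -/
lemma hullCount_eq_card (P : Finset (ℝ × ℝ)) (k j : ℕ) :
    hullCount P k j = ((P.powersetCard k).filter fun S : Finset (ℝ × ℝ) =>
      (Set.extremePoints ℝ (convexHull ℝ (S : Set (ℝ × ℝ)))).ncard = j).card := by
  symm
  unfold hullCount
  refine Finset.card_bij (fun S _ => (S : Set (ℝ × ℝ))) ?_ ?_ ?_
  · intro S hS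
    simp only [Finset.mem_filter, Finset.bind_def, Finset.pure_def, Finset.mem_sup,
      Finset.mem_singleton] at hS ⊢
    exact ⟨⟨S, hS.1, rfl⟩, hS.2⟩
  · intro S _ S' _ h
    exact Finset.coe_injective h
  · intro S hS
    simp only [Finset.mem_filter, Finset.bind_def, Finset.pure_def, Finset.mem_sup,
      Finset.mem_singleton] at hS
    obtain ⟨⟨Q, hQ, rfl⟩, h⟩ := hS
    exact ⟨Q, Finset.mem_filter.mpr ⟨hQ, h⟩, rfl⟩

/-- The sum over 3-element subsets `T` of `P` of the number of pairs of β-points of `T`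
lying in the same region with respect to `T` equals `U(P) + 2·T₂(P)`. -/
theorem sum_beta_same_region_pairs (P : Finset (ℝ × ℝ)) (n : ℕ) (hgp : GenPos P)
    (hcard : P.card = n) :
    ∑ T ∈ P.powersetCard 3, betaSamePairs P T =
      hullCount P 5 4 + 2 * hullCount P 5 3 := by
  classical
  rw [sum_betaSamePairs_eq hgp, hullCount_eq_card, hullCount_eq_card, Finset.card_filter,
    Finset.card_filter, Finset.mul_sum, ← Finset.sum_add_distrib]
  refine Finset.sum_congr rfl fun Q hQ => ?_
  obtain ⟨hQP, hQ5⟩ := Finset.mem_powersetCard.mp hQ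
  have h1 := ncard_extremePoints_add_card_nonextreme Q
  have h2 := three_le_card_extreme hgp hQP (by omega)
  rw [hQ5] at h1
  split_ifs <;> omega
end
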